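/- arXiv:math/0311284 — 3 statements merged into one kernel-verified Lean document; each statement's English description precedes it below -/
import Mathlib

section
/- Suppose positive integers λ₁ ≤ λ₂ ≤ λ₃ ≤ λ₄ with h = Σλᵢ satisfy: gcd(λᵢ,λⱼ)=1 for i≠j and Σᵢ{κλᵢ/h} = 2 for all κ ∈ {2,...,h-2}. Then (λ₁,λ₂,λ₃,λ₄) is one of (1,1,1,1), (1,1,1,2), (1,1,2,3), (1,2,3,5), (1,3,4,5), (2,3,5,7), (3,4,5,7). -/
/-- The integers `p, q, r, s` are the floors of `k * a / h, k * b / h, k * c / h, k * d / h`,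
expressed by linear inequalities. -/
def HasFloors (a b c d h k p q r s : ℤ) : Prop :=
  (p * h ≤ k * a ∧ k * a < (p + 1) * h) ∧ (q * h ≤ k * b ∧ k * b < (q + 1) * h) ∧
  (r * h ≤ k * c ∧ k * c < (r + 1) * h) ∧ (s * h ≤ k * d ∧ k * d < (s + 1) * h)

theorem hasFloors_iff {a b c d h k p q r s : ℤ} (hh : 0 < h) :
    HasFloors a b c d h k p q r s ↔
      k * a / h = p ∧ k * b / h = q ∧ k * c / h = r ∧ k * d / h = s := by
  simp only [HasFloors, Int.ediv_eq_iff_of_pos hh, add_mul, one_mul]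

theorem fract_intCast_div_intCast (n h : ℤ) (hh : 0 < h) :
    Int.fract ((n : ℚ) / (h : ℚ)) = ((n % h : ℤ) : ℚ) / h := by
  lift h to ℕ using hh.le
  exact_mod_cast Int.fract_div_intCast_eq_div_intCast_mod (k := ℚ) (m := n) (n := h)

/-- Consecutive floors differ by a unit jump in exactly one coordinate. -/
theorem HasFloors.succ {a b c d h k p q r s : ℤ} (hh : 0 < h)
    (ha : 0 ≤ a) (hb : 0 ≤ b) (hc : 0 ≤ c) (hd : 0 ≤ d)
    (hsum : ∀ κ, 2 ≤ κ → κ ≤ h - 2 → κ * a / h + κ * b / h + κ * c / h + κ * d / h = κ - 2)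
    (hk : 2 ≤ k) (hkh : k + 1 ≤ h - 2) (H : HasFloors a b c d h k p q r s) :
    HasFloors a b c d h (k + 1) p q r (s + 1) ∨ HasFloors a b c d h (k + 1) p q (r + 1) s ∨
    HasFloors a b c d h (k + 1) p (q + 1) r s ∨ HasFloors a b c d h (k + 1) (p + 1) q r s := by
  have mono : ∀ x, 0 ≤ x → k * x / h ≤ (k + 1) * x / h := fun x hx =>
    Int.ediv_le_ediv hh (by nlinarith)
  have h₁ := hsum k hk (by omega)
  have h₂ := hsum (k + 1) (by omega) hkh
  have := mono a ha
  have := mono b hb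
  have := mono c hc
  have := mono d hd
  simp only [hasFloors_iff hh] at H ⊢
  omega

set_option maxHeartbeats 10000000 in
theorem le_nineteen_of_sum_floors {a b c d h : ℤ} (ha : 0 < a) (hab : a ≤ b) (hbc : b ≤ c)
    (hcd : c ≤ d) (hh : h = a + b + c + d)
    (hsum : ∀ κ, 2 ≤ κ → κ ≤ h - 2 → κ * a / h + κ * b / h + κ * c / h + κ * d / h = κ - 2) :
    h ≤ 19 := by
  by_contra! hlt
  have hpos : 0 < h := by omega
  have nonneg : ∀ x, 0 ≤ x → 0 ≤ 2 * x / h := fun x hx => Int.ediv_nonneg (by omega) hpos.le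
  have H : HasFloors a b c d h 2 0 0 0 0 := by
    rw [hasFloors_iff hpos]
    have := hsum 2 le_rfl (by omega)
    have := nonneg a (by omega)
    have := nonneg b (by omega)
    have := nonneg c (by omega)
    have := nonneg d (by omega)
    omega
  have step := fun {k p q r s : ℤ} => HasFloors.succ (k := k) (p := p) (q := q) (r := r) (s := s)
    hpos ha.le (by omega) (by omega) (by omega) hsum
  have ⟨⟨_, _⟩, ⟨_, _⟩, ⟨_, _⟩, _, _⟩ := H
  iterate 16
    all_goals
      rcases step (by norm_num) (by linarith only [hlt]) H with H | H | H | H <;>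
      have ⟨⟨_, _⟩, ⟨_, _⟩, ⟨_, _⟩, _, _⟩ := H <;>
      simp only [Int.reduceAdd] at H <;>
      try (exfalso; linarith)

/-- The conditions on the weights of a Fano tetrahedron, with the fractional parts cleared of
denominators. -/
def IsTetrahedronWeight (a b c d : ℕ) : Prop :=
  (Nat.gcd a b = 1 ∧ Nat.gcd a c = 1 ∧ Nat.gcd a d = 1 ∧
    Nat.gcd b c = 1 ∧ Nat.gcd b d = 1 ∧ Nat.gcd c d = 1) ∧
  ∀ κ < a + b + c + d, 2 ≤ κ → κ + 2 ≤ a + b + c + d →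
    κ * a % (a + b + c + d) + κ * b % (a + b + c + d) + κ * c % (a + b + c + d) +
      κ * d % (a + b + c + d) = 2 * (a + b + c + d)

instance (a b c d : ℕ) : Decidable (IsTetrahedronWeight a b c d) :=
  inferInstanceAs (Decidable (_ ∧ _))

theorem IsTetrahedronWeight.mem_of_le_nineteen : ∀ d ∈ Finset.Icc 1 16,
    ∀ c ∈ Finset.Icc 1 d, ∀ b ∈ Finset.Icc 1 c, ∀ a ∈ Finset.Icc 1 b, a + b + c + d ≤ 19 → IsTetrahedronWeight a b c d →
    (a, b, c, d) ∈ [(1, 1, 1, 1), (1, 1, 1, 2), (1, 1, 2, 3), (1, 2, 3, 5), (1, 3, 4, 5),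
      (2, 3, 5, 7), (3, 4, 5, 7)] := by
  decide +kernel

theorem weights_classification
    (l : Fin 4 → ℤ) (hpos : ∀ i, 0 < l i)
    (hord : l 0 ≤ l 1 ∧ l 1 ≤ l 2 ∧ l 2 ≤ l 3)
    (h : ℤ) (hh : h = l 0 + l 1 + l 2 + l 3)
    (hcop : ∀ i j, i ≠ j → Int.gcd (l i) (l j) = 1)
    (hfract : ∀ κ : ℤ, 2 ≤ κ → κ ≤ h - 2 →
      (∑ i, Int.fract (((κ * l i : ℤ) : ℚ) / (h : ℚ))) = 2) :
    (l 0, l 1, l 2, l 3) = (1, 1, 1, 1) ∨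
    (l 0, l 1, l 2, l 3) = (1, 1, 1, 2) ∨
    (l 0, l 1, l 2, l 3) = (1, 1, 2, 3) ∨
    (l 0, l 1, l 2, l 3) = (1, 2, 3, 5) ∨
    (l 0, l 1, l 2, l 3) = (1, 3, 4, 5) ∨
    (l 0, l 1, l 2, l 3) = (2, 3, 5, 7) ∨
    (l 0, l 1, l 2, l 3) = (3, 4, 5, 7) := by
  obtain ⟨hab, hbc, hcd⟩ := hord
  have ha := hpos 0
  have hab' := hcop 0 1 (by decide)
  have hac' := hcop 0 2 (by decide)
  have had' := hcop 0 3 (by decide)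
  have hbc' := hcop 1 2 (by decide)
  have hbd' := hcop 1 3 (by decide)
  have hcd' := hcop 2 3 (by decide)
  have h_pos : 0 < h := by omega
  have hmod : ∀ κ : ℤ, 2 ≤ κ → κ ≤ h - 2 →
      κ * l 0 % h + κ * l 1 % h + κ * l 2 % h + κ * l 3 % h = 2 * h := by
    intro κ h₁ h₂
    have := hfract κ h₁ h₂
    have hne : (h : ℚ) ≠ 0 := by exact_mod_cast h_pos.ne'
    simp only [Fin.sum_univ_four, fract_intCast_div_intCast _ h h_pos, ← add_div,
      div_eq_iff hne] at this
    exact_mod_cast this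
  have hsum : ∀ κ : ℤ, 2 ≤ κ → κ ≤ h - 2 →
      κ * l 0 / h + κ * l 1 / h + κ * l 2 / h + κ * l 3 / h = κ - 2 := by
    intro κ h₁ h₂
    refine mul_left_cancel₀ h_pos.ne' ?_
    linear_combination Int.mul_ediv_add_emod (κ * l 0) h + Int.mul_ediv_add_emod (κ * l 1) h +
      Int.mul_ediv_add_emod (κ * l 2) h + Int.mul_ediv_add_emod (κ * l 3) h - hmod κ h₁ h₂ -
      κ * hh
  have hle := le_nineteen_of_sum_floors ha hab hbc hcd hh hsum
  generalize l 0 = a at *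
  generalize l 1 = b at *
  generalize l 2 = c at *
  generalize l 3 = d at *
  lift a to ℕ using by omega
  lift b to ℕ using by omega
  lift c to ℕ using by omega
  lift d to ℕ using by omega
  have key := IsTetrahedronWeight.mem_of_le_nineteen
    d (Finset.mem_Icc.2 (by omega)) c (Finset.mem_Icc.2 (by omega))
    b (Finset.mem_Icc.2 (by omega)) a (Finset.mem_Icc.2 (by omega)) (by omega)
    ⟨⟨hab', hac', had', hbc', hbd', hcd'⟩, fun κ _ h₁ h₂ => by
      have := hmod κ (by omega) (by omega)
      rw [hh] at this
      exact_mod_cast this⟩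
  simp only [List.mem_cons, List.not_mem_nil, or_false, Prod.mk.injEq] at key ⊢
  exact_mod_cast key
end

section
/- A lattice tetrahedron in ℤ³ containing no non-vertex lattice points can, by a translation and the action of GL(3,ℤ), be transformed to have vertices e₁, e₂, e₃, (x,y,z) with x, y ≥ 0 and z ≥ 1. -/
noncomputable def toR (x : Fin 3 → ℤ) : Fin 3 → ℝ := fun i => (x i : ℝ)

theorem exists_unimodular_annihilating (a b : ℤ) :
    ∃ s t u v : ℤ, s * v - t * u = 1 ∧ u * a + v * b = 0 := by
  by_cases h : Int.gcd a b = 0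
  · obtain ⟨rfl, rfl⟩ := Int.gcd_eq_zero_iff.mp h
    exact ⟨1, 0, 0, 1, by norm_num⟩
  · have hg : (Int.gcd a b : ℤ) ≠ 0 := by exact_mod_cast h
    obtain ⟨a', ha⟩ := Int.gcd_dvd_left a b
    obtain ⟨b', hb⟩ := Int.gcd_dvd_right a b
    have hbez := Int.gcd_eq_gcd_ab a b
    generalize Int.gcdA a b = s at hbez
    generalize Int.gcdB a b = t at hbez
    generalize (Int.gcd a b : ℤ) = g at *
    refine ⟨s, t, -b', a', mul_left_cancel₀ hg ?_, ?_⟩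
    · linear_combination (-s) * ha - t * hb - hbez
    · linear_combination (-b') * ha + a' * hb

theorem exists_upper_triangular (M : Matrix (Fin 3) (Fin 3) ℤ) :
    ∃ A : Matrix (Fin 3) (Fin 3) ℤ, A.det = 1 ∧
      (A * M) 1 0 = 0 ∧ (A * M) 2 0 = 0 ∧ (A * M) 2 1 = 0 := by
  obtain ⟨s₁, t₁, u₁, v₁, hdet₁, h₁⟩ := exists_unimodular_annihilating (M 1 0) (M 2 0)
  obtain ⟨s₂, t₂, u₂, v₂, hdet₂, h₂⟩ :=
    exists_unimodular_annihilating (M 0 0) (s₁ * M 1 0 + t₁ * M 2 0)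
  let B : Matrix (Fin 3) (Fin 3) ℤ :=
    !![s₂, t₂, 0; u₂, v₂, 0; 0, 0, 1] * !![1, 0, 0; 0, s₁, t₁; 0, u₁, v₁]
  obtain ⟨s₃, t₃, u₃, v₃, hdet₃, h₃⟩ :=
    exists_unimodular_annihilating ((B * M) 1 1) ((B * M) 2 1)
  have hB1 : (B * M) 1 0 = 0 := by
    simp [B, Matrix.mul_apply, Fin.sum_univ_three]
    linear_combination h₂
  have hB2 : (B * M) 2 0 = 0 := by
    simp [B, Matrix.mul_apply, Fin.sum_univ_three]
    linear_combination h₁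
  have hBdet : B.det = 1 := by
    rw [Matrix.det_mul]
    simp only [Matrix.det_fin_three, Matrix.of_apply, Matrix.cons_val]
    linear_combination (s₁ * v₁ - t₁ * u₁) * hdet₂ + hdet₁
  refine ⟨!![1, 0, 0; 0, s₃, t₃; 0, u₃, v₃] * B, ?_, ?_, ?_, ?_⟩
  · rw [Matrix.det_mul, hBdet, Matrix.det_fin_three]
    simp only [Matrix.of_apply, Matrix.cons_val]
    linear_combination hdet₃
  all_goals
    rw [Matrix.mul_assoc, Matrix.mul_apply, Fin.sum_univ_three]
    simp [hB1, hB2, h₃]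

theorem exists_hermite_normal_form (M : Matrix (Fin 3) (Fin 3) ℤ) (hM : M.det ≠ 0) :
    ∃ A : Matrix (Fin 3) (Fin 3) ℤ, IsUnit A.det ∧ ∃ d₁ d₂ d₃ a b c : ℤ,
      0 < d₁ ∧ 0 < d₂ ∧ 0 < d₃ ∧ 0 ≤ a ∧ a < d₂ ∧ 0 ≤ b ∧ b < d₃ ∧ 0 ≤ c ∧ c < d₃ ∧
      A * M = !![d₁, a, b; 0, d₂, c; 0, 0, d₃] := by
  obtain ⟨A, hA, h10, h20, h21⟩ := exists_upper_triangular M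
  have hdet : (A * M).det ≠ 0 := by rwa [Matrix.det_mul, hA, one_mul]
  generalize hH : A * M = H at *
  have hprod : H 0 0 * H 1 1 * H 2 2 ≠ 0 := by
    rw [Matrix.det_fin_three] at hdet
    simpa [h10, h20, h21] using hdet
  have h0 : H 0 0 ≠ 0 := by rintro h; simp [h] at hprod
  have h1 : H 1 1 ≠ 0 := by rintro h; simp [h] at hprod
  have h2 : H 2 2 ≠ 0 := by rintro h; simp [h] at hprod
  have key : ∀ d : ℤ, d ≠ 0 → ∃ ε : ℤ, IsUnit ε ∧ 0 < ε * d := by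
    intro d hd
    rcases lt_or_gt_of_ne hd with h | h
    · exact ⟨-1, by simp, by linarith⟩
    · exact ⟨1, by simp, by linarith⟩
  obtain ⟨ε₀, hε₀, hp₀⟩ := key _ h0
  obtain ⟨ε₁, hε₁, hp₁⟩ := key _ h1
  obtain ⟨ε₂, hε₂, hp₂⟩ := key _ h2
  set d₂ := ε₁ * H 1 1
  set d₃ := ε₂ * H 2 2
  set x := ε₀ * H 0 1 / d₂
  set z := ε₁ * H 1 2 / d₃
  set r := ε₀ * H 0 2 - x * (ε₁ * H 1 2)
  refine ⟨!![1, -x, -(r / d₃); 0, 1, -z; 0, 0, 1] * (Matrix.diagonal ![ε₀, ε₁, ε₂] * A), ?_,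
    ε₀ * H 0 0, d₂, d₃, ε₀ * H 0 1 % d₂, r % d₃, ε₁ * H 1 2 % d₃, hp₀, hp₁, hp₂,
    Int.emod_nonneg _ hp₁.ne', Int.emod_lt_of_pos _ hp₁, Int.emod_nonneg _ hp₂.ne',
    Int.emod_lt_of_pos _ hp₂, Int.emod_nonneg _ hp₂.ne', Int.emod_lt_of_pos _ hp₂, ?_⟩
  · rw [Matrix.det_mul, Matrix.det_mul, hA, Matrix.det_diagonal]
    simp [Matrix.det_fin_three, Fin.prod_univ_three, hε₀, hε₁, hε₂]
  · rw [Matrix.mul_assoc, Matrix.mul_assoc, hH]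
    ext i j
    fin_cases i <;> fin_cases j <;>
      simp [Matrix.mul_apply, Fin.sum_univ_three, Matrix.diagonal, h10, h20, h21, Int.emod_def] <;>
      ring

/-- The matrix whose columns are the edge vectors of a lattice tetrahedron at its first vertex. -/
def edgeMatrix (v : Fin 4 → Fin 3 → ℤ) : Matrix (Fin 3) (Fin 3) ℤ :=
  Matrix.of fun i j => v j.succ i - v 0 i

theorem edgeMatrix_det_ne_zero {v : Fin 4 → Fin 3 → ℤ}
    (hindep : AffineIndependent ℝ (fun i => toR (v i))) : (edgeMatrix v).det ≠ 0 := by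
  intro h
  obtain ⟨w, hw, hMw⟩ := Matrix.exists_mulVec_eq_zero_iff.mpr h
  apply hw
  rw [affineIndependent_iff] at hindep
  have hz := hindep Finset.univ
    (Fin.cons (-((w 0 : ℝ) + w 1 + w 2)) fun j => (w j : ℝ))
    (by simp [Fin.sum_univ_succ]; ring)
    (by
      ext i
      have hi := congrFun hMw i
      simp only [edgeMatrix, Matrix.mulVec, dotProduct, Fin.sum_univ_three, Matrix.of_apply,
        Pi.zero_apply] at hi
      have hi' := congrArg (Int.cast : ℤ → ℝ) hi
      push_cast at hi'
      simp [Fin.sum_univ_succ, toR] at hi' ⊢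
      linear_combination hi')
  ext j
  have := hz j.succ (Finset.mem_univ _)
  simpa using this

theorem exists_eq_of_nsmul_eq_sum {v : Fin 4 → Fin 3 → ℤ}
    (hfree : ∀ p : Fin 3 → ℤ,
      toR p ∈ convexHull ℝ (Set.range fun i => toR (v i)) → ∃ i, p = v i)
    {N : ℤ} (hN : 0 < N) {k : Fin 3 → ℤ} (hk : ∀ j, 0 ≤ k j) (hsum : ∑ j, k j ≤ N)
    {p : Fin 3 → ℤ} (hp : (edgeMatrix v).mulVec k = N • (p - v 0)) : ∃ i, p = v i := by
  apply hfree
  have hN' : (0 : ℝ) < N := by exact_mod_cast hN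
  have hmem : ∀ i, toR (v i) ∈ convexHull ℝ (Set.range fun i => toR (v i)) :=
    fun i => subset_convexHull ℝ _ ⟨i, rfl⟩
  have heq : toR p = ∑ i, (Fin.cons ((N - ∑ j, k j : ℤ) / N : ℝ)
      (fun j => (k j / N : ℝ)) : Fin 4 → ℝ) i • toR (v i) := by
    ext i
    have hi := congrArg (Int.cast : ℤ → ℝ) (congrFun hp i)
    simp [edgeMatrix, Matrix.mulVec, dotProduct, Fin.sum_univ_succ] at hi
    simp [Fin.sum_univ_succ, toR]
    field_simp
    linear_combination -hi
  rw [heq]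
  refine (convex_convexHull ℝ _).sum_mem ?_ ?_ fun i _ => hmem i
  · intro i _
    refine Fin.cases ?_ (fun j => ?_) i
    · exact div_nonneg (by exact_mod_cast sub_nonneg.mpr hsum) hN'.le
    · exact div_nonneg (by exact_mod_cast hk j) hN'.le
  · simp [Fin.sum_univ_succ]
    field_simp
    ring

theorem eq_zero_or_eq_col_of_empty {v : Fin 4 → Fin 3 → ℤ}
    (hfree : ∀ p : Fin 3 → ℤ,
      toR p ∈ convexHull ℝ (Set.range fun i => toR (v i)) → ∃ i, p = v i)
    {A H : Matrix (Fin 3) (Fin 3) ℤ} (hA : IsUnit A.det) (hH : A * edgeMatrix v = H)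
    {N : ℤ} (hN : 0 < N) {k : Fin 3 → ℤ} (hk : ∀ j, 0 ≤ k j) (hsum : ∑ j, k j ≤ N)
    {u : Fin 3 → ℤ} (hu : H.mulVec k = N • u) : u = 0 ∨ ∃ j, u = H.col j := by
  have hM : edgeMatrix v = A⁻¹ * H := by
    rw [← hH, Matrix.nonsing_inv_mul_cancel_left _ _ hA]
  obtain ⟨i, hi⟩ := exists_eq_of_nsmul_eq_sum hfree hN hk hsum (p := v 0 + A⁻¹.mulVec u) (by
    rw [add_sub_cancel_left, hM, ← Matrix.mulVec_mulVec, hu, Matrix.mulVec_smul])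
  have hu' : u = A.mulVec (v i - v 0) := by
    rw [← hi, add_sub_cancel_left, Matrix.mulVec_mulVec, Matrix.mul_nonsing_inv _ hA,
      Matrix.one_mulVec]
  revert hu'
  refine Fin.cases (fun h => Or.inl ?_) (fun j h => Or.inr ⟨j, ?_⟩) i
  · simpa using h
  · rw [h, ← hH]
    rfl

theorem empty_tetrahedron_normal_form
    (v : Fin 4 → Fin 3 → ℤ)
    (hindep : AffineIndependent ℝ (fun i => toR (v i)))
    (hfree : ∀ p : Fin 3 → ℤ,
      toR p ∈ convexHull ℝ (Set.range fun i => toR (v i)) → ∃ i, p = v i) :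
    ∃ A : Matrix (Fin 3) (Fin 3) ℤ, IsUnit A.det ∧
    ∃ t : Fin 3 → ℤ, ∃ x y z : ℤ, 0 ≤ x ∧ 0 ≤ y ∧ 1 ≤ z ∧
      (Set.range fun i => A.mulVec (v i) + t) =
        ({![1, 0, 0], ![0, 1, 0], ![0, 0, 1], ![x, y, z]} : Set (Fin 3 → ℤ)) := by
  obtain ⟨A, hA, d₁, d₂, d₃, a, b, c, hd₁, hd₂, hd₃, ha, had, hb, hbd, hc, hcd, hH⟩ :=
    exists_hermite_normal_form _ (edgeMatrix_det_ne_zero hindep)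
  have empty : ∀ N k₀ k₁ k₂ u₀ u₁ u₂ : ℤ, 0 < N → 0 ≤ k₀ → 0 ≤ k₁ → 0 ≤ k₂ →
      k₀ + k₁ + k₂ ≤ N → d₁ * k₀ + a * k₁ + b * k₂ = N * u₀ → d₂ * k₁ + c * k₂ = N * u₁ →
      d₃ * k₂ = N * u₂ →
      (u₀ = 0 ∧ u₁ = 0 ∧ u₂ = 0) ∨ (u₀ = d₁ ∧ u₁ = 0 ∧ u₂ = 0) ∨
      (u₀ = a ∧ u₁ = d₂ ∧ u₂ = 0) ∨ (u₀ = b ∧ u₁ = c ∧ u₂ = d₃) := by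
    intro N k₀ k₁ k₂ u₀ u₁ u₂ hN h₀ h₁ h₂ hs e₀ e₁ e₂
    have := eq_zero_or_eq_col_of_empty hfree hA hH hN (k := ![k₀, k₁, k₂]) (u := ![u₀, u₁, u₂])
      (by simp [Fin.forall_fin_succ, h₀, h₁, h₂])
      (by simpa [Fin.sum_univ_three] using hs)
      (by
        ext i
        fin_cases i <;> simp [Matrix.mulVec, dotProduct, Fin.sum_univ_three, e₀, e₁, e₂])
    simpa [funext_iff, Fin.forall_fin_succ, Fin.exists_fin_succ] using this
  obtain rfl : d₁ = 1 := by
    have := empty d₁ 1 0 0 1 0 0 hd₁ (by lia) (by lia) (by lia) (by lia) (by ring) (by ring)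
      (by ring)
    lia
  obtain rfl : d₂ = 1 := by
    by_contra hne
    rcases ha.eq_or_lt with rfl | ha
    · have := empty d₂ 0 1 0 0 1 0 hd₂ (by lia) (by lia) (by lia) (by lia) (by ring) (by ring)
        (by ring)
      lia
    · have := empty d₂ (d₂ - a) 1 0 1 1 0 hd₂ (by lia) (by lia) (by lia) (by lia) (by ring)
        (by ring) (by ring)
      lia
  obtain rfl : a = 0 := by lia
  have hz : 1 ≤ d₃ + 1 - b - c := by
    by_contra hlt
    have := empty d₃ (d₃ - b) (d₃ - c) 1 1 1 1 hd₃ (by lia) (by lia) (by lia) (by lia) (by ring)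
      (by ring) (by ring)
    lia
  set C : Matrix (Fin 3) (Fin 3) ℤ := !![1, 0, 0; 0, 1, 0; -1, -1, 1] with hC
  have hvert : ∀ j : Fin 3, (C * A).mulVec (v j.succ) + (![0, 0, 1] - (C * A).mulVec (v 0)) =
      (C * (A * edgeMatrix v)).col j + ![0, 0, 1] := by
    intro j
    have : (C * (A * edgeMatrix v)).col j = (C * A).mulVec (v j.succ - v 0) := by
      rw [← Matrix.mul_assoc]
      rfl
    rw [this, Matrix.mulVec_sub]
    abel
  refine ⟨C * A, ?_, ![0, 0, 1] - (C * A).mulVec (v 0), b, c, d₃ + 1 - b - c, hb, hc, hz, ?_⟩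
  · rw [Matrix.det_mul]
    simpa [hC, Matrix.det_fin_three] using hA
  · have h₀ := hvert 0
    have h₁ := hvert 1
    have h₂ := hvert 2
    rw [hH] at h₀ h₁ h₂
    have e₀ : (C * A).mulVec (v 1) + (![0, 0, 1] - (C * A).mulVec (v 0)) = ![1, 0, 0] := by
      refine h₀.trans ?_
      ext i
      fin_cases i <;> simp [hC]
    have e₁ : (C * A).mulVec (v 2) + (![0, 0, 1] - (C * A).mulVec (v 0)) = ![0, 1, 0] := by
      refine h₁.trans ?_
      ext i
      fin_cases i <;> simp [hC]
    have e₂ : (C * A).mulVec (v 3) + (![0, 0, 1] - (C * A).mulVec (v 0)) =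
        ![b, c, d₃ + 1 - b - c] := by
      refine h₂.trans ?_
      ext i
      fin_cases i <;> simp [hC]
      ring
    have e : (fun i => (C * A).mulVec (v i) + (![0, 0, 1] - (C * A).mulVec (v 0))) =
        ![![0, 0, 1], ![1, 0, 0], ![0, 1, 0], ![b, c, d₃ + 1 - b - c]] := by
      funext i
      fin_cases i
      exacts [add_sub_cancel _ _, e₀, e₁, e₂]
    rw [e]
    ext p
    simp only [Set.mem_range, Fin.exists_fin_succ, Set.mem_insert_iff, Set.mem_singleton_iff,
      eq_comm (a := p)]
    simp
    tauto
end

section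
/- Let a lattice tetrahedron in ℤ³ with vertices e₁, e₂, e₃, (x,y,z), where x,y,z ≥ 1, contain no non-vertex lattice points. Then at least one of x, y, z equals 1. -/
theorem Int.mul_ediv_add_le {N w s : ℤ} (hN : 0 < N) (hs : s * w < N) (k : ℤ) :
    (k + s) * w / N ≤ k * w / N + 1 := by
  have h : (k + s) * w / N < k * w / N + 2 := by
    rw [Int.ediv_lt_iff_lt_mul hN]
    have := Int.lt_ediv_add_one_mul_self (k * w) hN
    linarith
  omega

theorem Int.add_one_le_mul_ediv {N y s : ℤ} (hN : 0 < N) (hs : N ≤ s * y) (k : ℤ) :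
    k * y / N + 1 ≤ (k + s) * y / N := by
  rw [Int.le_ediv_iff_mul_le hN]
  have := Int.ediv_mul_le (k * y) hN.ne'
  linarith

theorem Int.exists_first_multiple_ge {N z : ℤ} (hN : 0 < N) (hz : 0 < z) :
    ∃ m, 0 < m ∧ (m - 1) * z < N ∧ N ≤ m * z := by
  refine ⟨(N - 1) / z + 1, ?_, ?_, ?_⟩
  · have := Int.ediv_nonneg (show 0 ≤ N - 1 by omega) hz.le
    omega
  · have := Int.ediv_mul_le (N - 1) hz.ne'
    linarith
  · have := Int.lt_ediv_add_one_mul_self (N - 1) hz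
    omega

/-- If the floor sequence of slope `w / N` with `w = y + z - 1` is the sum of those of slopes `y / N`
and `z / N`, then the sequence of slope `y / N` cannot share the first jump `q`: the first jump of
the sequence of slope `z / N` would lie in a window of length at least `q` free of jumps of the
sequence of slope `y / N`. -/
theorem floor_split_false {N w y z q : ℤ} (hy : 2 ≤ y) (hz : 2 ≤ z) (hw : w = y + z - 1)
    (hN : 2 * w < N) (hq : (q - 1) * w < N) (hqy : N ≤ q * y)
    (hsplit : ∀ k, 0 ≤ k → k < N → k * w / N = k * y / N + k * z / N) : False := by
  have hN0 : 0 < N := by omega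
  have hq3 : 3 ≤ q := by
    by_contra! h
    nlinarith
  obtain ⟨m, hm0, hm1, hm2⟩ := Int.exists_first_multiple_ge hN0 (show 0 < z by omega)
  have hq2 : (q - 1) * 3 ≤ (q - 1) * w := by gcongr <;> omega
  have hm3 : (m - 1) * 2 ≤ (m - 1) * z := by gcongr; omega
  have hqm : q ≤ m := by
    by_contra! h
    have h1 : m * (w - z + 1) ≤ (q - 1) * w - m * (z - 1) := by nlinarith
    have h2 : m * z ≤ (q - 1) * w := by nlinarith
    omega
  have am := hsplit m (by omega) (by omega)
  have am' := hsplit (m - 1) (by omega) (by omega)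
  have aa := hsplit (m - q + 1) (by omega) (by omega)
  have ab := hsplit (m + q - 2) (by omega) (by omega)
  have wm := Int.mul_ediv_add_le hN0 hq (m - q + 1)
  have wb := Int.mul_ediv_add_le hN0 hq (m - 1)
  rw [show m - q + 1 + (q - 1) = m by ring] at wm
  rw [show m - 1 + (q - 1) = m + q - 2 by ring] at wb
  have mono : ∀ {v i j : ℤ}, 0 ≤ v → i ≤ j → i * v / N ≤ j * v / N := fun hv hij =>
    Int.ediv_le_ediv hN0 (mul_le_mul_of_nonneg_right hij hv)
  have zm' : (m - 1) * z / N < 1 := by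
    rw [Int.ediv_lt_iff_lt_mul hN0]; omega
  have zm : 1 ≤ m * z / N := by
    rw [Int.le_ediv_iff_mul_le hN0]; omega
  have ym : (m - 1) * y / N ≤ m * y / N := mono (by omega) (by omega)
  have za : (m - q + 1) * z / N ≤ (m - 1) * z / N := mono (by omega) (by omega)
  have zb : m * z / N ≤ (m + q - 2) * z / N := mono (by omega) (by omega)
  have yq := Int.add_one_le_mul_ediv hN0 hqy (m - q + 1)
  have yb : (m - q + 1 + q) * y / N ≤ (m + q - 2) * y / N := mono (by omega) (by omega)
  omega

theorem floor_sum_false {N x y z : ℤ} (hy : 2 ≤ y) (hz : 2 ≤ z) (hN : N = x + y + z - 1)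
    (hx : N < 2 * x) (hsum : ∀ k, 0 < k → k < N → k * x / N + k * y / N + k * z / N = k - 1)
    (hdiv : ∀ k, 0 < k → k < N → k * x ≠ N * (k * x / N)) : False := by
  have hN0 : 0 < N := by omega
  obtain ⟨w, hw⟩ : ∃ w, w = y + z - 1 := ⟨_, rfl⟩
  have hsplit : ∀ k, 0 ≤ k → k < N → k * w / N = k * y / N + k * z / N := by
    intro k hk hkN
    rcases hk.eq_or_lt with rfl | hk
    · simp
    have h1 := hsum k hk hkN
    have h2 := hdiv k hk hkN
    have h3 := Int.mul_ediv_self_le (x := k * x) hN0.ne'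
    have h4 := Int.lt_mul_ediv_self_add (x := k * x) hN0
    have h5 : k * w = k * N - k * x := by rw [hw, hN]; ring
    have h6 : k * w / N = k - 1 - k * x / N := by
      apply le_antisymm
      · rw [← Int.lt_add_one_iff, Int.ediv_lt_iff_lt_mul hN0, h5]
        have : N * (k * x / N) < k * x := lt_of_le_of_ne h3 h2.symm
        linarith
      · rw [Int.le_ediv_iff_mul_le hN0, h5]
        linarith
    omega
  obtain ⟨q, hq0, hq1, hq2⟩ := Int.exists_first_multiple_ge hN0 (show 0 < w by omega)
  have hqN : q < N := by
    have : (q - 1) * 3 ≤ (q - 1) * w := by gcongr <;> omega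
    omega
  have hq := hsplit q hq0.le hqN
  have hq' : 1 ≤ q * w / N := by
    rw [Int.le_ediv_iff_mul_le hN0]; omega
  by_cases h : N ≤ q * y
  · exact floor_split_false hy hz hw (by omega) hq1 h hsplit
  · have h1 : q * y / N < 1 := by
      rw [Int.ediv_lt_iff_lt_mul hN0]; omega
    have h2 : 1 ≤ q * z / N := by omega
    rw [Int.le_ediv_iff_mul_le hN0] at h2
    exact floor_split_false hz hy (by omega) (by omega) hq1 (by omega)
      (fun k hk hkN => by rw [hsplit k hk hkN, add_comm])

theorem toR_mem_convexHull_tetrahedron {x y z k a b c : ℤ} (hN : 0 < x + y + z - 1) (hk : 0 ≤ k)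
    (habc : a + b + c = k + 1) (ha : k * x ≤ (x + y + z - 1) * a)
    (hb : k * y ≤ (x + y + z - 1) * b) (hc : k * z ≤ (x + y + z - 1) * c) :
    toR ![a, b, c] ∈ convexHull ℝ
      ({toR ![1, 0, 0], toR ![0, 1, 0], toR ![0, 0, 1], toR ![x, y, z]} :
        Set (Fin 3 → ℝ)) := by
  obtain ⟨N, hNe⟩ : ∃ N, N = x + y + z - 1 := ⟨_, rfl⟩
  rw [← hNe] at hN ha hb hc
  have hN' : (0 : ℝ) < N := by exact_mod_cast hN
  have hNe' : (N : ℝ) = x + y + z - 1 := by exact_mod_cast hNe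
  have hs : (a : ℝ) + b + c = k + 1 := by exact_mod_cast habc
  have weight_nonneg : ∀ {u v : ℤ}, k * u ≤ N * v → (0 : ℝ) ≤ v - k * u / N := by
    intro u v h
    rw [sub_nonneg, div_le_iff₀ hN', mul_comm (v : ℝ)]
    exact_mod_cast h
  have key := (convex_convexHull ℝ
    ({toR ![1, 0, 0], toR ![0, 1, 0], toR ![0, 0, 1], toR ![x, y, z]} :
      Set (Fin 3 → ℝ))).sum_mem (t := Finset.univ)
    (w := ![(a : ℝ) - k * x / N, b - k * y / N, c - k * z / N, k / N])
    (z := ![toR ![1, 0, 0], toR ![0, 1, 0], toR ![0, 0, 1], toR ![x, y, z]]) ?_ ?_ ?_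
  · convert key using 1
    ext i
    fin_cases i <;> simp [Fin.sum_univ_four, toR] <;> ring
  · intro i _
    fin_cases i
    · exact weight_nonneg ha
    · exact weight_nonneg hb
    · exact weight_nonneg hc
    · exact div_nonneg (by exact_mod_cast hk) hN'.le
  · simp only [Fin.sum_univ_four, Matrix.cons_val]
    field_simp
    linear_combination (N : ℝ) * hs + (k : ℝ) * hNe'
  · intro i _
    apply subset_convexHull
    fin_cases i <;> simp

theorem empty_tetrahedron_howe
    (x y z : ℤ) (hx : 1 ≤ x) (hy : 1 ≤ y) (hz : 1 ≤ z)
    (hfree : ∀ p : Fin 3 → ℤ,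
      toR p ∈ convexHull ℝ
        ({toR ![1, 0, 0], toR ![0, 1, 0], toR ![0, 0, 1], toR ![x, y, z]} :
          Set (Fin 3 → ℝ)) →
      p = ![1, 0, 0] ∨ p = ![0, 1, 0] ∨ p = ![0, 0, 1] ∨ p = ![x, y, z]) :
    x = 1 ∨ y = 1 ∨ z = 1 := by
  by_contra! hne
  obtain ⟨hx1, hy1, hz1⟩ := hne
  obtain ⟨N, hN⟩ : ∃ N, N = x + y + z - 1 := ⟨_, rfl⟩
  have hN0 : 0 < N := by omega
  have hempty : ∀ k a b c : ℤ, 0 < k → k < N → a + b + c = k + 1 →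
      k * x ≤ N * a → k * y ≤ N * b → k * z ≤ N * c → False := by
    intro k a b c hk hkN habc ha hb hc
    rw [hN] at ha hb hc
    rcases hfree _ (toR_mem_convexHull_tetrahedron (by omega) hk.le habc ha hb hc) with
      h | h | h | h <;>
    · have h0 := congrFun h 0
      have h1 := congrFun h 1
      have h2 := congrFun h 2
      simp at h0 h1 h2
      omega
  have floor_le : ∀ v : ℤ, N * (v / N) ≤ v := fun v => Int.mul_ediv_self_le hN0.ne'
  have lt_floor : ∀ v : ℤ, v < N * (v / N) + N := fun v => Int.lt_mul_ediv_self_add hN0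
  have hsum : ∀ k, 0 < k → k < N → k * x / N + k * y / N + k * z / N = k - 1 := by
    intro k hk hkN
    have lx := floor_le (k * x)
    have ly := floor_le (k * y)
    have lz := floor_le (k * z)
    have ux := lt_floor (k * x)
    have uy := lt_floor (k * y)
    have uz := lt_floor (k * z)
    apply le_antisymm
    · by_contra! h
      refine hempty (N - k) (x - k * x / N) (y - k * y / N)
        (N - k + 1 - (x - k * x / N) - (y - k * y / N)) (by omega) (by omega) (by ring)
        (by linarith) (by linarith) ?_
      have : N * (z - k * z / N) ≤ N * (N - k + 1 - (x - k * x / N) - (y - k * y / N)) :=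
        mul_le_mul_of_nonneg_left (by omega) hN0.le
      linarith
    · by_contra! h
      refine hempty k (k * x / N + 1) (k * y / N + 1)
        (k + 1 - (k * x / N + 1) - (k * y / N + 1)) hk hkN (by ring)
        (by linarith) (by linarith) ?_
      have : N * (k * z / N + 1) ≤ N * (k + 1 - (k * x / N + 1) - (k * y / N + 1)) :=
        mul_le_mul_of_nonneg_left (by omega) hN0.le
      linarith
  have hdiv : ∀ k, 0 < k → k < N → k * x ≠ N * (k * x / N) ∧ k * y ≠ N * (k * y / N) ∧
      k * z ≠ N * (k * z / N) := by
    intro k hk hkN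
    have h := hsum k hk hkN
    have ux := lt_floor (k * x)
    have uy := lt_floor (k * y)
    have uz := lt_floor (k * z)
    refine ⟨fun e => ?_, fun e => ?_, fun e => ?_⟩
    · exact hempty k (k * x / N) (k * y / N + 1) (k * z / N + 1) hk hkN (by omega)
        e.le (by linarith) (by linarith)
    · exact hempty k (k * x / N + 1) (k * y / N) (k * z / N + 1) hk hkN (by omega)
        (by linarith) e.le (by linarith)
    · exact hempty k (k * x / N + 1) (k * y / N + 1) (k * z / N) hk hkN (by omega)
        (by linarith) (by linarith) e.le
  have large_of_floor : ∀ {v : ℤ}, 1 ≤ 2 * v / N → 2 * v ≠ N * (2 * v / N) → v < N → N < 2 * v := by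
    intro v h1 h2 h3
    have h4 : 2 * v / N < 2 := by
      rw [Int.ediv_lt_iff_lt_mul hN0]; omega
    have h5 : 2 * v / N = 1 := by omega
    rw [Int.le_ediv_iff_mul_le hN0] at h1
    rw [h5] at h2
    omega
  have h2 := hsum 2 (by omega) (by omega)
  obtain ⟨dx, dy, dz⟩ := hdiv 2 (by omega) (by omega)
  have hcases : 1 ≤ 2 * x / N ∨ 1 ≤ 2 * y / N ∨ 1 ≤ 2 * z / N := by omega
  rcases hcases with h | h | h
  · exact floor_sum_false (x := x) (y := y) (z := z) (by omega) (by omega) hN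
      (large_of_floor h dx (by omega)) hsum (fun k hk hkN => (hdiv k hk hkN).1)
  · exact floor_sum_false (x := y) (y := x) (z := z) (by omega) (by omega) (by omega)
      (large_of_floor h dy (by omega)) (fun k hk hkN => by have := hsum k hk hkN; omega)
      (fun k hk hkN => (hdiv k hk hkN).2.1)
  · exact floor_sum_false (x := z) (y := x) (z := y) (by omega) (by omega) (by omega)
      (large_of_floor h dz (by omega)) (fun k hk hkN => by have := hsum k hk hkN; omega)
      (fun k hk hkN => (hdiv k hk hkN).2.2)
end
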